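/- Let g ∈ ℝⁿ with g ≠ 0, let B be a symmetric n×n real matrix, let σ > 0 and f_k ∈ ℝ, define φ₁(α) = f_k − α ‖g‖² + (1/2) α² gᵀBg + (1/3) α³ σ ‖g‖³, and let ᾱ = 2‖g‖² / (√((gᵀBg)² + 4σ‖g‖⁵) + gᵀBg) be its minimizer over (0, ∞). Then the model value at the approximately optimal stepsize is strictly below the current function value: φ₁(ᾱ) < f_k = φ₁(0). -/

import Mathlib

open scoped RealInnerProductSpace

/-- The cubic regularization model value at the approximately optimal stepsize
`ᾱ = 2‖g‖²/(√((gᵀBg)² + 4σ‖g‖⁵) + gᵀBg)` is strictly below the current function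
value: `φ₁(ᾱ) < f_k = φ₁(0)`. -/
theorem stmt16 (n : ℕ) (g : EuclideanSpace ℝ (Fin n)) (hg : g ≠ 0)
    (B : Matrix (Fin n) (Fin n) ℝ) (hB : B.IsSymm)
    (σ fk : ℝ) (hσ : 0 < σ)
    (φ : ℝ → ℝ)
    (hφ : ∀ α, φ α = fk - α * ‖g‖ ^ 2 + 1 / 2 * α ^ 2 * ⟪g, Matrix.toEuclideanLin B g⟫
      + 1 / 3 * α ^ 3 * σ * ‖g‖ ^ 3)
    (αb : ℝ)
    (hαb : αb = 2 * ‖g‖ ^ 2 /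
      (Real.sqrt (⟪g, Matrix.toEuclideanLin B g⟫ ^ 2 + 4 * σ * ‖g‖ ^ 5)
        + ⟪g, Matrix.toEuclideanLin B g⟫)) :
    φ αb < fk ∧ φ 0 = fk := by
  have hN : 0 < ‖g‖ := norm_pos_iff.mpr hg
  generalize ⟪g, Matrix.toEuclideanLin B g⟫ = b at *
  generalize ‖g‖ = N at *
  refine ⟨?_, by rw [hφ]; ring⟩
  have hp : 0 < 4 * σ * N ^ 5 := by positivity
  have hs2 := Real.sq_sqrt (show 0 ≤ b ^ 2 + 4 * σ * N ^ 5 by positivity)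
  have hlt : |b| < Real.sqrt (b ^ 2 + 4 * σ * N ^ 5) := by
    apply Real.lt_sqrt_of_sq_lt
    rw [sq_abs]
    linarith
  generalize Real.sqrt (b ^ 2 + 4 * σ * N ^ 5) = s at *
  have hd : 0 < s + b := by linarith [neg_abs_le b]
  have hα : 0 < αb := by rw [hαb]; positivity
  have hm : αb * (s + b) = 2 * N ^ 2 := by
    rw [hαb]; field_simp
  have hst : αb * b = N ^ 2 - αb ^ 2 * σ * N ^ 3 := by
    have h1 : αb * s = 2 * N ^ 2 - αb * b := by linarith
    have h2 : (αb * s) ^ 2 = (2 * N ^ 2 - αb * b) ^ 2 := by rw [h1]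
    rw [mul_pow, hs2] at h2
    have hN2 : N ^ 2 ≠ 0 := by positivity
    apply mul_left_cancel₀ hN2
    linarith
  rw [hφ]
  have key : fk - αb * N ^ 2 + 1 / 2 * αb ^ 2 * b + 1 / 3 * αb ^ 3 * σ * N ^ 3
      = fk - (αb * N ^ 2 / 2 + αb ^ 3 * σ * N ^ 3 / 6) := by
    linear_combination (αb / 2) * hst
  rw [key]
  have : 0 < αb * N ^ 2 / 2 + αb ^ 3 * σ * N ^ 3 / 6 := by positivity
  linarith
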